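/- arXiv:2406.16656 — 3 statements merged into one kernel-verified Lean document; each statement's English description precedes it below -/
import Mathlib

section
/- For any two permutations π, σ ∈ S_n, d_H(f(π̄), f(σ̄)) ≤ (3/2)·d_L(π,σ), where d_L is the Levenshtein distance. -/
open scoped Classical

/-- A translocation: move the symbol at (0-indexed) position `i` to position `j`,
shifting intermediate symbols by one position. -/
def translocate {α : Type*} (l : List α) (i j : ℕ) : List α :=
  match l[i]? with
  | some a => (l.eraseIdx i).insertIdx j a
  | none => l

/-- The Ulam distance between two sequences: the minimum number of translocations
needed to transform `x` into `y`. -/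
noncomputable def ulamDist {α : Type*} (x y : List α) : ℕ :=
  sInf {m | ∃ g : ℕ → List α, g 0 = x ∧ g m = y ∧
    ∀ k < m, ∃ i j, i < (g k).length ∧ j < (g k).length ∧ i ≠ j ∧
      g (k+1) = translocate (g k) i j}

/-- The sequence form of a permutation of `{1,...,n}` (values written `1`-indexed). -/
def seqOf {n : ℕ} (π : Equiv.Perm (Fin n)) : List ℕ :=
  List.ofFn fun i => (π i : ℕ) + 1

/-- The Ulam distance between two permutations. -/
noncomputable def dU {n : ℕ} (π σ : Equiv.Perm (Fin n)) : ℕ :=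
  ulamDist (seqOf π) (seqOf σ)

/-- Length of a longest common subsequence of two sequences. -/
noncomputable def lcsLen {α : Type*} (x y : List α) : ℕ :=
  sSup {k | ∃ z : List α, z.Sublist x ∧ z.Sublist y ∧ z.length = k}

/-- Levenshtein distance: minimum number of insertions and deletions needed to
transform `x` into `y`. -/
noncomputable def levDist {α : Type*} (x y : List α) : ℕ :=
  sInf {m | ∃ g : ℕ → List α, g 0 = x ∧ g m = y ∧
    ∀ k < m, (∃ i a, i ≤ (g k).length ∧ g (k+1) = (g k).insertIdx i a) ∨
      (∃ i, i < (g k).length ∧ g (k+1) = (g k).eraseIdx i)}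

/-- Hamming distance between two permutations: number of positions where they differ. -/
def dH {m : ℕ} (a b : Equiv.Perm (Fin m)) : ℕ :=
  (Finset.univ.filter fun i => a i ≠ b i).card

/-- `bar π` = the permutation `π` of `{1,...,n}` extended to `{1,...,n+1}` by
appending the symbol `n+1` at the end (i.e. fixing the last point). -/
def bar {n : ℕ} (π : Equiv.Perm (Fin n)) : Equiv.Perm (Fin (n+1)) :=
  (Equiv.permCongr finSuccEquivLast).symm π.optionCongr

/-- The map `f : S_n → S_{n+1}`: `fmap π` sends each symbol `i` to the symbol
that cyclically follows `i` in the sequence form of `bar π`, i.e.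
`f(π̄)_i = π̄_{π̄⁻¹(i)+1}` for `i ≤ n` and `f(π̄)_{n+1} = π̄_1`. -/
def fmap {n : ℕ} (π : Equiv.Perm (Fin n)) : Equiv.Perm (Fin (n+1)) :=
  bar π * finRotate (n+1) * (bar π)⁻¹

/-- The deletion ball `D_t(π)`: all sequences of length `n - t` obtained from `π`
by deleting `t` symbols, i.e. all subsequences of `π` of length `n - t`. -/
def Dball {n : ℕ} (t : ℕ) (π : Equiv.Perm (Fin n)) : Set (List ℕ) :=
  {s | s.Sublist (seqOf π) ∧ s.length = n - t}

/-- `Mnt n t`: the maximum size of a subset of `S_n` whose distinct elements have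
pairwise Ulam distance greater than `t`. -/
noncomputable def Mnt (n t : ℕ) : ℕ :=
  sSup {m | ∃ C : Finset (Equiv.Perm (Fin n)),
    (∀ π ∈ C, ∀ σ ∈ C, π ≠ σ → t < dU π σ) ∧ C.card = m}

lemma bar_symm_last {n : ℕ} (π : Equiv.Perm (Fin n)) :
    (bar π).symm (Fin.last n) = Fin.last n := by
  rw [Equiv.symm_apply_eq]
  simp [bar, Equiv.permCongr]

lemma bar_symm_castSucc {n : ℕ} (π : Equiv.Perm (Fin n)) (i : Fin n) :
    (bar π).symm i.castSucc = (π.symm i).castSucc := by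
  rw [Equiv.symm_apply_eq]
  simp [bar, Equiv.permCongr]

/-- The cyclic successor of a symbol other than the last one sits one position further. -/
lemma val_bar_symm_fmap {n : ℕ} (π : Equiv.Perm (Fin n)) {i : Fin (n + 1)}
    (hi : i ≠ Fin.last n) :
    ((bar π).symm (fmap π i) : ℕ) = (bar π).symm i + 1 := by
  have h : (bar π).symm i ≠ Fin.last n := fun h => hi <| by
    rw [← (bar π).apply_symm_apply i, h, ← bar_symm_last π, Equiv.apply_symm_apply,
      bar_symm_last]
  simpa [fmap] using coe_finRotate_of_ne_last h

lemma bar_symm_fmap_last {n : ℕ} (π : Equiv.Perm (Fin n)) :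
    (bar π).symm (fmap π (Fin.last n)) = 0 := by
  simp [fmap, bar_symm_last]

/-- If three symbols `i`, `fmap π i`, `fmap σ i` belong to a set on which `bar π` and `bar σ`
induce the same order, then `fmap π i = fmap σ i`. -/
lemma fmap_eq_fmap_of_order_agree {n : ℕ} {π σ : Equiv.Perm (Fin n)} {P : Fin (n + 1) → Prop}
    (hP : ∀ a b, P a → P b → ((bar π).symm a < (bar π).symm b ↔ (bar σ).symm a < (bar σ).symm b))
    {i : Fin (n + 1)} (hi : P i) (hπ : P (fmap π i)) (hσ : P (fmap σ i)) :
    fmap π i = fmap σ i := by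
  by_contra hne
  have hne' : ((bar π).symm (fmap π i) : ℕ) ≠ (bar π).symm (fmap σ i) := fun h =>
    hne ((bar π).symm.injective (Fin.ext h))
  have h₁ := hP _ _ hπ hσ
  have h₂ := hP _ _ hi hπ
  have h₃ := hP _ _ hi hσ
  simp only [Fin.lt_def] at h₁ h₂ h₃
  by_cases hl : i = Fin.last n
  · subst hl
    have e₁ := congrArg Fin.val (bar_symm_fmap_last π)
    have e₂ := congrArg Fin.val (bar_symm_fmap_last σ)
    simp only [Fin.val_zero] at e₁ e₂
    omega
  · have e₁ := val_bar_symm_fmap π hl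
    have e₂ := val_bar_symm_fmap σ hl
    omega

/-- Deleting the complement of a common subsequence changes `fmap` in at most three positions
per deleted symbol. -/
lemma dH_fmap_le_of_sublist {n : ℕ} (π σ : Equiv.Perm (Fin n)) {z : List ℕ}
    (hπ : z.Sublist (seqOf π)) (hσ : z.Sublist (seqOf σ)) :
    dH (fmap π) (fmap σ) ≤ 3 * (n - z.length) := by
  obtain ⟨p, hp⟩ := List.sublist_iff_exists_fin_orderEmbedding_get_eq.1 hπ
  obtain ⟨q, hq⟩ := List.sublist_iff_exists_fin_orderEmbedding_get_eq.1 hσ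
  have lπ : (seqOf π).length = n := by simp [seqOf]
  have lσ : (seqOf σ).length = n := by simp [seqOf]
  let s : Fin z.length → Fin n := fun i => π ((p i).cast lπ)
  have hs : ∀ i, s i = σ ((q i).cast lσ) := fun i => by
    have h := (hp i).symm.trans (hq i)
    simp only [seqOf, List.get_eq_getElem, List.getElem_ofFn, Nat.add_right_cancel_iff] at h
    exact Fin.ext h
  have sinj : Function.Injective s := fun i j h => by
    simpa [s] using h
  let T : Finset (Fin (n + 1)) := ((Finset.univ.image s)ᶜ).map Fin.castSuccEmb
  have cT : T.card = n - z.length := by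
    simp [T, Finset.card_compl, Finset.card_image_of_injective _ sinj]
  have mem : ∀ a, a ∉ T → a = Fin.last n ∨ ∃ i, a = (s i).castSucc := fun a ha => by
    induction a using Fin.lastCases with
    | last => exact Or.inl rfl
    | cast b =>
      right
      by_contra! h
      refine ha (Finset.mem_map.2 ⟨b, ?_, rfl⟩)
      simp only [Finset.mem_compl, Finset.mem_image, Finset.mem_univ, true_and, not_exists]
      exact fun i hi => h i (by rw [hi])
  have sπ : ∀ i, π.symm (s i) = (p i).cast lπ := fun i => by simp [s]
  have sσ : ∀ i, σ.symm (s i) = (q i).cast lσ := fun i => by simp [hs]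
  have key : ∀ a b, a ∉ T → b ∉ T →
      ((bar π).symm a < (bar π).symm b ↔ (bar σ).symm a < (bar σ).symm b) := by
    intro a b ha hb
    rcases mem a ha with rfl | ⟨i, rfl⟩ <;> rcases mem b hb with rfl | ⟨j, rfl⟩ <;>
      simp [bar_symm_last, bar_symm_castSucc, sπ, sσ, Fin.castSucc_lt_last, (Fin.le_last _).not_gt]
  have hsub : (Finset.univ.filter fun i => fmap π i ≠ fmap σ i) ⊆
      T ∪ (T.image (fmap π).symm ∪ T.image (fmap σ).symm) := by
    intro i hi
    by_contra h
    simp only [Finset.mem_union, Finset.mem_image, not_or, not_exists, not_and] at h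
    obtain ⟨h₁, h₂, h₃⟩ := h
    exact (Finset.mem_filter.1 hi).2 <| fmap_eq_fmap_of_order_agree (P := (· ∉ T)) key h₁
      (fun h => h₂ _ h (by simp)) (fun h => h₃ _ h (by simp))
  have c₀ := Finset.card_le_card hsub
  have c₁ := Finset.card_union_le T (T.image (fmap π).symm ∪ T.image (fmap σ).symm)
  have c₂ := Finset.card_union_le (T.image (fmap π).symm) (T.image (fmap σ).symm)
  have c₃ := Finset.card_image_le (s := T) (f := (fmap π).symm)
  have c₄ := Finset.card_image_le (s := T) (f := (fmap σ).symm)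
  have : dH (fmap π) (fmap σ) = (Finset.univ.filter fun i => fmap π i ≠ fmap σ i).card := by
    unfold dH; congr!
  omega

/-- A sublist loses at most one symbol when one symbol of the ambient list is erased. -/
lemma exists_sublist_eraseIdx {α : Type*} {z l : List α} (h : z.Sublist l) (i : ℕ) :
    ∃ w : List α, w.Sublist z ∧ w.Sublist (l.eraseIdx i) ∧ z.length ≤ w.length + 1 := by
  induction h generalizing i with
  | slnil => exact ⟨[], by simp⟩
  | @cons l₁ l₂ a h ih =>
    cases i with
    | zero => exact ⟨l₁, List.Sublist.refl _, by simpa using h, by simp⟩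
    | succ i =>
      obtain ⟨w, h₁, h₂, h₃⟩ := ih i
      exact ⟨w, h₁, by simpa using h₂.cons a, h₃⟩
  | @cons_cons l₁ l₂ a h ih =>
    cases i with
    | zero => exact ⟨l₁, List.sublist_cons_self _ _, by simpa using h, by simp⟩
    | succ i =>
      obtain ⟨w, h₁, h₂, h₃⟩ := ih i
      exact ⟨a :: w, h₁.cons_cons a, by simpa using h₂.cons_cons a, by simpa using h₃⟩

/-- The set of lengths of edit paths from `x` to `y` is nonempty. -/
lemma exists_edit_path {α : Type*} (x y : List α) :
    ∃ m, ∃ g : ℕ → List α, g 0 = x ∧ g m = y ∧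
      ∀ k < m, (∃ i a, i ≤ (g k).length ∧ g (k+1) = (g k).insertIdx i a) ∨
        (∃ i, i < (g k).length ∧ g (k+1) = (g k).eraseIdx i) := by
  refine ⟨x.length + y.length, fun k => if k < x.length then x.drop k else
    y.drop (x.length + y.length - k), ?_, ?_, fun k hk => ?_⟩
  · cases x <;> simp
  · simp
  · by_cases h : k < x.length
    · right
      refine ⟨0, by simp [h], ?_⟩
      by_cases h' : k + 1 < x.length
      · simp [h, h', List.eraseIdx_zero]
      · have : x.length = k + 1 := by omega
        simp [this, List.eraseIdx_zero]
    · left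
      have h' : ¬ k + 1 < x.length := by omega
      have h'' : x.length + y.length - (k + 1) < y.length := by omega
      refine ⟨0, y[x.length + y.length - (k + 1)], by simp, ?_⟩
      simp only [h, h', if_false, List.insertIdx_zero]
      rw [List.drop_eq_getElem_cons h'']
      congr 2
      omega

/-- The endpoints of a short edit path have a long common subsequence. -/
lemma exists_common_sublist {α : Type*} (x y : List α) :
    ∃ z : List α, z.Sublist x ∧ z.Sublist y ∧
      x.length + y.length ≤ 2 * z.length + levDist x y := by
  obtain ⟨g, h0, hm, hg⟩ := Nat.sInf_mem (exists_edit_path x y)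
  change g (levDist x y) = y at hm
  change ∀ k < levDist x y, _ at hg
  have key : ∀ k ≤ levDist x y, ∃ z : List α, z.Sublist x ∧ z.Sublist (g k) ∧
      x.length + (g k).length ≤ 2 * z.length + k := by
    intro k
    induction k with
    | zero => exact fun _ => ⟨x, List.Sublist.refl _, by simp [h0], by simp [h0]; omega⟩
    | succ k ih =>
      intro hk
      obtain ⟨z, z₁, z₂, z₃⟩ := ih (by omega)
      rcases hg k hk with ⟨i, a, hi, e⟩ | ⟨i, hi, e⟩
      · refine ⟨z, z₁, e ▸ z₂.trans (List.sublist_insertIdx _ _ _), ?_⟩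
        rw [e, List.length_insertIdx_of_le_length hi]
        omega
      · obtain ⟨w, w₁, w₂, w₃⟩ := exists_sublist_eraseIdx z₂ i
        refine ⟨w, w₁.trans z₁, e ▸ w₂, ?_⟩
        rw [e, List.length_eraseIdx_of_lt hi]
        omega
  simpa only [hm] using key _ le_rfl

/-- `d_H(f(π̄), f(σ̄)) ≤ (3/2)·d_L(π,σ)`. -/
theorem stmt14 (n : ℕ) (π σ : Equiv.Perm (Fin n)) :
    2 * dH (fmap π) (fmap σ) ≤ 3 * levDist (seqOf π) (seqOf σ) := by
  obtain ⟨z, h₁, h₂, h₃⟩ := exists_common_sublist (seqOf π) (seqOf σ)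
  have h := dH_fmap_le_of_sublist π σ h₁ h₂
  simp only [seqOf, List.length_ofFn] at h₃ ⊢
  omega
end

section
/- For any two permutations π, σ ∈ S_n, d_H(f(π̄), f(σ̄)) ≤ 4·d_C(π,σ), where d_C is the generalized Cayley distance. -/
open scoped Classical

/-- Swap the two disjoint blocks of positions `[i,j)` and `[k,m)` (with `j ≤ k`)
of a sequence. -/
def swapGenBlocks {α : Type*} (l : List α) (i j k m : ℕ) : List α :=
  l.take i ++ ((l.drop k).take (m - k)) ++ ((l.drop j).take (k - j)) ++
    ((l.drop i).take (j - i)) ++ l.drop m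

/-- Generalized Cayley distance: minimum number of generalized transpositions
(swaps of two nonempty disjoint blocks) needed to transform `x` into `y`. -/
noncomputable def genCayleyDist {α : Type*} (x y : List α) : ℕ :=
  sInf {c | ∃ g : ℕ → List α, g 0 = x ∧ g c = y ∧
    ∀ l < c, ∃ i j k m, i < j ∧ j ≤ k ∧ k < m ∧ m ≤ (g l).length ∧
      g (l+1) = swapGenBlocks (g l) i j k m}

/-- The relation "`y` arises from `x` by one swap of two nonempty disjoint blocks". -/
def BlockSwap {α : Type*} (x y : List α) : Prop :=
  ∃ i j k m, i < j ∧ j ≤ k ∧ k < m ∧ m ≤ x.length ∧ y = swapGenBlocks x i j k m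

theorem BlockSwap.cons {α : Type*} (a : α) {x y : List α} (h : BlockSwap x y) :
    BlockSwap (a :: x) (a :: y) := by
  obtain ⟨i, j, k, m, hij, hjk, hkm, hm, rfl⟩ := h
  exact ⟨i + 1, j + 1, k + 1, m + 1, by omega, by omega, by omega, by simpa using hm,
    by simp [swapGenBlocks]⟩

theorem blockSwap_swap {α : Type*} (a b : α) (l : List α) :
    BlockSwap (a :: b :: l) (b :: a :: l) :=
  ⟨0, 1, 1, 2, by simp [swapGenBlocks]⟩

theorem reflTransGen_blockSwap_of_perm {α : Type*} {x y : List α} (h : x.Perm y) :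
    Relation.ReflTransGen BlockSwap x y := by
  induction h with
  | nil => rfl
  | cons a _ ih => exact ih.lift (List.cons a) fun _ _ h => h.cons a
  | swap a b l => exact .single (blockSwap_swap b a l)
  | trans _ _ ih₁ ih₂ => exact ih₁.trans ih₂

theorem exists_chain_of_reflTransGen {α : Type*} {r : α → α → Prop} {x y : α}
    (h : Relation.ReflTransGen r x y) :
    ∃ (c : ℕ) (g : ℕ → α), g 0 = x ∧ g c = y ∧ ∀ l < c, r (g l) (g (l + 1)) := by
  induction h using Relation.ReflTransGen.head_induction_on with
  | refl => exact ⟨0, fun _ => y, rfl, rfl, by simp⟩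
  | @head a b hab _ ih =>
    obtain ⟨c, g, hg0, hgc, hg⟩ := ih
    refine ⟨c + 1, fun | 0 => a | l + 1 => g l, rfl, hgc, fun l hl => ?_⟩
    cases l with
    | zero => simpa [hg0] using hab
    | succ l => exact hg l (by omega)

/-- For lists that are permutations of each other, the infimum defining the generalized
Cayley distance is attained. -/
theorem exists_chain_genCayleyDist {α : Type*} {x y : List α} (h : x.Perm y) :
    ∃ g : ℕ → List α, g 0 = x ∧ g (genCayleyDist x y) = y ∧
      ∀ l < genCayleyDist x y, BlockSwap (g l) (g (l + 1)) :=
  Nat.sInf_mem (exists_chain_of_reflTransGen (reflTransGen_blockSwap_of_perm h))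

/-- The pairs of consecutive entries of a list. -/
def consecPairs {α : Type*} (l : List α) : Set (α × α) :=
  {p | [p.1, p.2] <:+: l}

theorem consecPairs_mono {α : Type*} {x y : List α} (h : x <:+: y) :
    consecPairs x ⊆ consecPairs y :=
  fun _ hp => List.IsInfix.trans hp h

/-- The pairs joining the last entry of `x` to the first entry of `y`. -/
def junction {α : Type*} (x y : List α) : Set (α × α) :=
  {p | p.1 ∈ x.getLast? ∧ p.2 ∈ y.head?}

theorem encard_junction_le {α : Type*} (x y : List α) : (junction x y).encard ≤ 1 := by
  rw [Set.encard_le_one_iff]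
  rintro ⟨a, b⟩ ⟨c, d⟩ ⟨h₁, h₂⟩ ⟨h₃, h₄⟩
  exact Prod.ext (Option.mem_unique h₁ h₃) (Option.mem_unique h₂ h₄)

theorem consecPairs_append_subset {α : Type*} (x y : List α) :
    consecPairs (x ++ y) ⊆ consecPairs x ∪ consecPairs y ∪ junction x y := by
  rintro ⟨a, b⟩ h
  induction x with
  | nil => exact Or.inl (Or.inr h)
  | cons c x ih =>
    rcases List.infix_cons_iff.1 h with h | h
    · cases x with
      | nil =>
        cases y <;> simp_all [junction, List.cons_prefix_cons]
      | cons d x =>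
        obtain ⟨rfl, rfl, -⟩ := by simpa [List.cons_prefix_cons] using h
        exact Or.inl (Or.inl (List.infix_cons_iff.2 (Or.inl (by simp [List.cons_prefix_cons]))))
    · rcases ih h with (h | h) | h
      · exact Or.inl (Or.inl (List.infix_cons_iff.2 (Or.inr h)))
      · exact Or.inl (Or.inr h)
      · refine Or.inr ⟨?_, h.2⟩
        have := h.1
        cases x <;> simp_all [List.getLast?_cons_cons]

theorem encard_consecPairs_diff_le_of_blocks {α : Type*} (A B C D E : List α) :
    (consecPairs (A ++ (B ++ (C ++ (D ++ E)))) \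
      consecPairs (A ++ (D ++ (C ++ (B ++ E))))).encard ≤ 4 := by
  set y := A ++ (D ++ (C ++ (B ++ E))) with hy
  have hA : consecPairs A ⊆ consecPairs y :=
    consecPairs_mono ⟨[], D ++ (C ++ (B ++ E)), by simp [hy]⟩
  have hB : consecPairs B ⊆ consecPairs y := consecPairs_mono ⟨A ++ D ++ C, E, by simp [hy]⟩
  have hC : consecPairs C ⊆ consecPairs y := consecPairs_mono ⟨A ++ D, B ++ E, by simp [hy]⟩
  have hD : consecPairs D ⊆ consecPairs y := consecPairs_mono ⟨A, C ++ B ++ E, by simp [hy]⟩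
  have hE : consecPairs E ⊆ consecPairs y :=
    consecPairs_mono ⟨A ++ D ++ C ++ B, [], by simp [hy]⟩
  have hsub : consecPairs (A ++ (B ++ (C ++ (D ++ E)))) \ consecPairs y ⊆
      junction A (B ++ (C ++ (D ++ E))) ∪ junction B (C ++ (D ++ E)) ∪
        junction C (D ++ E) ∪ junction D E := by
    rintro p ⟨hp, hpy⟩
    rcases consecPairs_append_subset _ _ hp with (h | hp) | h
    · exact absurd (hA h) hpy
    · rcases consecPairs_append_subset _ _ hp with (h | hp) | h
      · exact absurd (hB h) hpy
      · rcases consecPairs_append_subset _ _ hp with (h | hp) | h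
        · exact absurd (hC h) hpy
        · rcases consecPairs_append_subset _ _ hp with (h | h) | h
          · exact absurd (hD h) hpy
          · exact absurd (hE h) hpy
          · exact Or.inr h
        · exact Or.inl (Or.inr h)
      · exact Or.inl (Or.inl (Or.inr h))
    · exact Or.inl (Or.inl (Or.inl h))
  calc _ ≤ _ := Set.encard_le_encard hsub
    _ ≤ 1 + 1 + 1 + 1 := by
      refine (Set.encard_union_le _ _).trans (add_le_add ?_ (encard_junction_le _ _))
      refine (Set.encard_union_le _ _).trans (add_le_add ?_ (encard_junction_le _ _))
      exact (Set.encard_union_le _ _).trans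
        (add_le_add (encard_junction_le _ _) (encard_junction_le _ _))
    _ = 4 := by norm_num

theorem eq_append_blocks {α : Type*} (l : List α) {i j k m : ℕ} (hij : i ≤ j) (hjk : j ≤ k)
    (hkm : k ≤ m) :
    l = l.take i ++ ((l.drop i).take (j - i) ++ ((l.drop j).take (k - j) ++
      ((l.drop k).take (m - k) ++ l.drop m))) := by
  have h : ∀ {a b : ℕ}, a ≤ b → l.drop a = (l.drop a).take (b - a) ++ l.drop b := by
    intro a b hab
    conv_lhs => rw [← List.take_append_drop (b - a) (l.drop a)]
    rw [List.drop_drop, Nat.add_sub_cancel' hab]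
  rw [← h hkm, ← h hjk, ← h hij, List.take_append_drop]

theorem BlockSwap.encard_consecPairs_diff_le {α : Type*} (a : α) {x y : List α}
    (h : BlockSwap x y) :
    (consecPairs (a :: x ++ [a]) \ consecPairs (a :: y ++ [a])).encard ≤ 4 := by
  obtain ⟨i, j, k, m, hij, hjk, hkm, -, rfl⟩ := h
  have := encard_consecPairs_diff_le_of_blocks (a :: x.take i) ((x.drop i).take (j - i))
    ((x.drop j).take (k - j)) ((x.drop k).take (m - k)) (x.drop m ++ [a])
  have hx := congrArg (fun l => a :: l ++ [a]) (eq_append_blocks x hij.le hjk hkm.le)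
  simp only [List.cons_append, List.append_assoc] at hx this
  simp only [swapGenBlocks, List.cons_append, List.append_assoc]
  rwa [hx]

theorem encard_consecPairs_diff_le_of_chain {α : Type*} (a : α) (g : ℕ → List α) (c : ℕ)
    (hg : ∀ l < c, BlockSwap (g l) (g (l + 1))) :
    (consecPairs (a :: g 0 ++ [a]) \ consecPairs (a :: g c ++ [a])).encard ≤
      ((4 * c : ℕ) : ℕ∞) := by
  induction c with
  | zero => simp
  | succ c ih =>
    calc _ ≤ _ := Set.encard_le_encard
          (sdiff_triangle _ (consecPairs (a :: g c ++ [a])) _)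
      _ ≤ _ := Set.encard_union_le _ _
      _ ≤ ((4 * c : ℕ) : ℕ∞) + 4 := add_le_add (ih fun l hl => hg l (by omega))
          ((hg c c.lt_succ_self).encard_consecPairs_diff_le a)
      _ = _ := by push_cast; ring

theorem mem_consecPairs_iff {α : Type*} {l : List α} {a b : α} :
    (a, b) ∈ consecPairs l ↔ ∃ i, l[i]? = some a ∧ l[i + 1]? = some b := by
  induction l with
  | nil => simp [consecPairs]
  | cons c l ih =>
    have h : (a, b) ∈ consecPairs (c :: l) ↔
        [a, b] <+: c :: l ∨ (a, b) ∈ consecPairs l := List.infix_cons_iff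
    rw [h, ih]
    constructor
    · rintro (h | ⟨i, hi⟩)
      · obtain ⟨t, ht⟩ := h
        exact ⟨0, by simp [← ht], by simp [← ht]⟩
      · exact ⟨i + 1, by simpa using hi⟩
    · rintro ⟨_ | i, h₁, h₂⟩
      · left
        cases l <;> simp_all [List.cons_prefix_cons]
      · exact Or.inr ⟨i, by simpa using h₁, by simpa using h₂⟩

theorem bar_castSucc {n : ℕ} (π : Equiv.Perm (Fin n)) (i : Fin n) :
    bar π i.castSucc = (π i).castSucc := by
  simp [bar]

theorem bar_last {n : ℕ} (π : Equiv.Perm (Fin n)) : bar π (Fin.last n) = Fin.last n := by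
  simp [bar]

theorem seqOf_append_last {n : ℕ} (π : Equiv.Perm (Fin n)) :
    seqOf π ++ [n + 1] = List.ofFn fun i => (bar π i : ℕ) + 1 := by
  rw [List.ofFn_succ_last]
  simp [seqOf, bar_castSucc, bar_last]

/-- The graph of `fmap π` is the set of consecutive pairs of the sequence of `bar π`, read
cyclically. -/
theorem mem_consecPairs_seqOf_iff {n : ℕ} (π : Equiv.Perm (Fin n)) (a b : Fin (n + 1)) :
    ((a : ℕ) + 1, (b : ℕ) + 1) ∈ consecPairs ((n + 1) :: seqOf π ++ [n + 1]) ↔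
      fmap π a = b := by
  rw [List.cons_append, seqOf_append_last, mem_consecPairs_iff]
  obtain ⟨i, rfl⟩ := (bar π).surjective a
  obtain ⟨j, rfl⟩ := (bar π).surjective b
  have hf : fmap π (bar π i) = bar π j ↔ finRotate (n + 1) i = j := by simp [fmap]
  rw [hf]
  have hb (p q : Fin (n + 1)) : (bar π p : ℕ) = bar π q ↔ p = q := by
    rw [Fin.val_inj, (bar π).injective.eq_iff]
  have hl (q : Fin (n + 1)) : n = (bar π q : ℕ) ↔ Fin.last n = q := by
    rw [← hb, bar_last, Fin.val_last]
  constructor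
  · rintro ⟨_ | k, h₁, h₂⟩
    · simp [hl] at h₁
      simp [hb] at h₂
      rw [← h₁, finRotate_last, ← h₂]
    · simp only [List.getElem?_cons_succ, List.getElem?_ofFn] at h₁ h₂
      split_ifs at h₁ h₂ with hk hk'
      simp [hb] at h₁ h₂
      subst h₁ h₂
      exact finRotate_of_lt (by omega)
  · rintro rfl
    induction i using Fin.lastCases with
    | last => exact ⟨0, by simp [bar_last], by simp⟩
    | cast i =>
      refine ⟨i + 1, ?_, ?_⟩
      · rw [List.getElem?_cons_succ, List.getElem?_ofFn, dif_pos (Nat.lt_succ_of_lt i.2)]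
        rfl
      · rw [List.getElem?_cons_succ, List.getElem?_ofFn, dif_pos (Nat.succ_lt_succ i.2)]
        exact congrArg (fun p => some ((bar π p : ℕ) + 1)) (finRotate_of_lt i.2).symm

theorem dH_fmap_le {n : ℕ} (π σ : Equiv.Perm (Fin n)) :
    (dH (fmap π) (fmap σ) : ℕ∞) ≤ (consecPairs ((n + 1) :: seqOf π ++ [n + 1]) \
      consecPairs ((n + 1) :: seqOf σ ++ [n + 1])).encard := by
  rw [dH, ← Set.encard_coe_eq_coe_finsetCard]
  refine Set.encard_le_encard_of_injOn
    (f := fun a => ((a : ℕ) + 1, (fmap π a : ℕ) + 1)) ?_ ?_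
  · intro a ha
    refine ⟨(mem_consecPairs_seqOf_iff π a _).2 rfl, fun h => ?_⟩
    have hne : fmap π a ≠ fmap σ a := by simpa using ha
    exact hne ((mem_consecPairs_seqOf_iff σ a _).1 h).symm
  · intro a _ b _ h
    simpa [Fin.val_inj] using congrArg Prod.fst h

theorem seqOf_perm {n : ℕ} (π σ : Equiv.Perm (Fin n)) : (seqOf π).Perm (seqOf σ) := by
  have h (τ : Equiv.Perm (Fin n)) : (seqOf τ).Perm (List.ofFn fun i : Fin n => (i : ℕ) + 1) :=
    Equiv.Perm.ofFn_comp_perm τ (fun i : Fin n => (i : ℕ) + 1)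
  exact (h π).trans (h σ).symm

/-- `d_H(f(π̄), f(σ̄)) ≤ 4·d_C(π,σ)`. -/
theorem stmt17 (n : ℕ) (π σ : Equiv.Perm (Fin n)) :
    dH (fmap π) (fmap σ) ≤ 4 * genCayleyDist (seqOf π) (seqOf σ) := by
  obtain ⟨g, hg0, hgc, hg⟩ := exists_chain_genCayleyDist (seqOf_perm π σ)
  have h := encard_consecPairs_diff_le_of_chain (n + 1) g _ hg
  rw [hg0, hgc] at h
  exact_mod_cast (dH_fmap_le π σ).trans h
end

section
/- For integers t, n with n + 1 ≥ 3t + 1 ≥ 4, let C_H ⊆ S_{n+1} be a permutation code of minimum Hamming distance 3t + 1. Then the permutation code P_t(n) = { π ∈ S_n : f(π̄) ∈ C_H } is capable of correcting t deletions, i.e., D_t(π) ∩ D_t(σ) = ∅ for all distinct π, σ ∈ P_t(n). -/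
open scoped Classical

theorem bar_injective {n : ℕ} : Function.Injective (bar (n := n)) := fun π σ h =>
  Equiv.ext fun i => Fin.castSucc_injective n <| by
    rw [← bar_castSucc, ← bar_castSucc, h]

theorem seqOf_bar {n : ℕ} (π : Equiv.Perm (Fin n)) : seqOf (bar π) = seqOf π ++ [n + 1] := by
  rw [seqOf, List.ofFn_succ_last]
  simp [seqOf, bar_castSucc, bar_last]

theorem fmap_bar_apply {n : ℕ} (π : Equiv.Perm (Fin n)) (i : Fin (n + 1)) :
    fmap π (bar π i) = bar π (i + 1) := by
  simp [fmap]

theorem fmap_injective {n : ℕ} : Function.Injective (fmap (n := n)) := by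
  intro π σ h
  refine bar_injective (Equiv.ext fun i => ?_)
  induction i using Fin.induction with
  | zero =>
    rw [← Fin.last_add_one n, ← fmap_bar_apply, ← fmap_bar_apply, bar_last, bar_last, h]
  | succ i ih =>
    rw [← Fin.coeSucc_eq_succ, ← fmap_bar_apply, ← fmap_bar_apply, ih, h]

theorem nodup_seqOf {n : ℕ} (p : Equiv.Perm (Fin n)) : (seqOf p).Nodup :=
  List.nodup_ofFn.2 fun i j h => by
    simpa [Fin.val_inj] using h

theorem pairwise_seqOf {n : ℕ} (p : Equiv.Perm (Fin n)) :
    (seqOf p).Pairwise fun a b =>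
      ∀ x y : Fin n, a = (x : ℕ) + 1 → b = (y : ℕ) + 1 → p⁻¹ x < p⁻¹ y := by
  refine List.pairwise_ofFn.2 fun i j hij x y hx hy => ?_
  obtain rfl : p i = x := Fin.ext (Nat.succ_injective hx)
  obtain rfl : p j = y := Fin.ext (Nat.succ_injective hy)
  simpa using hij

/-- A common subsequence of two permutations lists its symbols in the same relative order. -/
theorem inv_lt_inv_iff_of_sublist {n : ℕ} {p q : Equiv.Perm (Fin n)} {s : List ℕ}
    (hp : s.Sublist (seqOf p)) (hq : s.Sublist (seqOf q)) {x y : Fin n}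
    (hx : (x : ℕ) + 1 ∈ s) (hy : (y : ℕ) + 1 ∈ s) :
    p⁻¹ x < p⁻¹ y ↔ q⁻¹ x < q⁻¹ y := by
  let R : ℕ → ℕ → Prop := fun a b => ∀ x y : Fin n, a = (x : ℕ) + 1 → b = (y : ℕ) + 1 →
    ((p⁻¹ x < p⁻¹ y ↔ q⁻¹ x < q⁻¹ y) ∧ (p⁻¹ y < p⁻¹ x ↔ q⁻¹ y < q⁻¹ x))
  have : Std.Symm R := ⟨fun a b h x y hx hy => (h y x hy hx).symm⟩
  have hrefl : ∀ a ∈ s, R a a := by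
    intro a _ x y hx hy
    obtain rfl : x = y := Fin.ext (by omega)
    simp
  have hpair : s.Pairwise R :=
    (((pairwise_seqOf p).sublist hp).and ((pairwise_seqOf q).sublist hq)).imp
      fun h x y hx hy => by
        have h₁ := h.1 x y hx hy
        have h₂ := h.2 x y hx hy
        exact ⟨iff_of_true h₁ h₂, iff_of_false h₁.not_gt h₂.not_gt⟩
  have hall : ∀ a ∈ s, ∀ b ∈ s, R a b := fun a ha b hb =>
    hpair.forall_of_forall hrefl ha hb
  exact (hall _ hx _ hy x y rfl rfl).1

/-- If two orderings agree on a set of symbols, then a symbol of the set whose cyclic successors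
in both orderings belong to the set has the same successor in both. -/
theorem fmap_apply_eq_of_order_agree {n : ℕ} {π σ : Equiv.Perm (Fin n)} {T : Set (Fin (n + 1))}
    (hT : ∀ x ∈ T, ∀ y ∈ T, (bar π)⁻¹ x < (bar π)⁻¹ y ↔ (bar σ)⁻¹ x < (bar σ)⁻¹ y)
    {a : Fin (n + 1)} (ha : a ∈ T) (hb : fmap π a ∈ T) (hc : fmap σ a ∈ T) :
    fmap π a = fmap σ a := by
  have succ_inv (τ : Equiv.Perm (Fin n)) : (bar τ)⁻¹ (fmap τ a) = (bar τ)⁻¹ a + 1 := by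
    simp [fmap]
  have hπ := succ_inv π
  have hσ := succ_inv σ
  set b := fmap π a
  set c := fmap σ a
  have hbc := hT b hb c hc
  have hcb := hT c hc b hb
  suffices h : (bar π)⁻¹ b = (bar π)⁻¹ c from (bar π)⁻¹.injective h
  by_contra hne
  have hne' : (bar σ)⁻¹ b ≠ (bar σ)⁻¹ c := fun h => hne (by rw [(bar σ)⁻¹.injective h])
  by_cases hl : a = Fin.last n
  · have inv_last (τ : Equiv.Perm (Fin n)) : (bar τ)⁻¹ (Fin.last n) = Fin.last n := by
      rw [Equiv.Perm.inv_eq_iff_eq, bar_last]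
    rw [hl, inv_last, Fin.last_add_one] at hπ hσ
    rw [hπ] at hne hbc
    rw [hσ] at hne' hbc
    exact Fin.not_lt_zero _ (hbc.1 (Fin.pos_iff_ne_zero.2 (Ne.symm hne)))
  · have val_succ (τ : Equiv.Perm (Fin n)) :
        (((bar τ)⁻¹ a + 1 : Fin (n + 1)) : ℕ) = ((bar τ)⁻¹ a : ℕ) + 1 := by
      refine Fin.val_add_one_of_lt (Fin.lt_last_iff_ne_last.2 fun h => hl ?_)
      rw [Equiv.Perm.inv_eq_iff_eq, bar_last] at h
      exact h
    have hab := hT a ha b hb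
    have hac := hT a ha c hc
    have h₁ := val_succ π
    have h₂ := val_succ σ
    rw [← hπ] at h₁
    rw [← hσ] at h₂
    simp only [Fin.lt_def, ne_eq, Fin.ext_iff] at *
    omega

/-- Two permutations that agree on every point of `T` that both map into `T` differ in at most
three times as many points as `T` omits. -/
theorem dH_le_three_mul_card_compl {m : ℕ} {g h : Equiv.Perm (Fin m)} (T : Finset (Fin m))
    (hT : ∀ a ∈ T, g a ∈ T → h a ∈ T → g a = h a) : dH g h ≤ 3 * Tᶜ.card := by
  have hsub : (Finset.univ.filter fun i => g i ≠ h i) ⊆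
      (Tᶜ ∪ Tᶜ.image ⇑g⁻¹) ∪ Tᶜ.image ⇑h⁻¹ := by
    intro a ha
    by_contra hmem
    simp only [Finset.mem_union, Finset.mem_image, Finset.mem_compl, not_or, not_exists,
      not_and, not_not] at hmem
    refine (Finset.mem_filter.1 ha).2 (hT a hmem.1.1 ?_ ?_)
    · by_contra hg
      exact hmem.1.2 _ hg (by simp)
    · by_contra hh
      exact hmem.2 _ hh (by simp)
  calc dH g h ≤ ((Tᶜ ∪ Tᶜ.image ⇑g⁻¹) ∪ Tᶜ.image ⇑h⁻¹).card := Finset.card_le_card hsub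
    _ ≤ (Tᶜ.card + (Tᶜ.image ⇑g⁻¹).card) + (Tᶜ.image ⇑h⁻¹).card :=
      (Finset.card_union_le _ _).trans (Nat.add_le_add_right (Finset.card_union_le _ _) _)
    _ ≤ (Tᶜ.card + Tᶜ.card) + Tᶜ.card :=
      Nat.add_le_add (Nat.add_le_add_left Finset.card_image_le _) Finset.card_image_le
    _ = 3 * Tᶜ.card := by ring

/-- The number of symbols of a permutation that occur in a given subsequence. -/
theorem length_le_card_symbols {m : ℕ} {p : Equiv.Perm (Fin m)} {s : List ℕ}
    (hs : s.Sublist (seqOf p)) :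
    s.length ≤ (Finset.univ.filter fun x : Fin m => (x : ℕ) + 1 ∈ s).card := by
  rw [← List.toFinset_card_of_nodup (hs.nodup (nodup_seqOf p))]
  refine (Finset.card_le_card fun a ha => ?_).trans
    (Finset.card_image_le (f := fun x : Fin m => (x : ℕ) + 1))
  have has : a ∈ s := List.mem_toFinset.1 ha
  obtain ⟨i, rfl⟩ := List.mem_ofFn.1 (hs.subset has)
  exact Finset.mem_image.2 ⟨p i, Finset.mem_filter.2 ⟨Finset.mem_univ _, has⟩, rfl⟩

theorem dH_fmap_le_of_common_subsequence {n : ℕ} {π σ : Equiv.Perm (Fin n)} {s : List ℕ}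
    (hπ : s.Sublist (seqOf π)) (hσ : s.Sublist (seqOf σ)) :
    dH (fmap π) (fmap σ) ≤ 3 * (n - s.length) := by
  have hπ' : (s ++ [n + 1]).Sublist (seqOf (bar π)) := by
    rw [seqOf_bar]; exact hπ.append_right _
  have hσ' : (s ++ [n + 1]).Sublist (seqOf (bar σ)) := by
    rw [seqOf_bar]; exact hσ.append_right _
  set T := Finset.univ.filter fun x : Fin (n + 1) => (x : ℕ) + 1 ∈ s ++ [n + 1] with hTdef
  have hcard : s.length + 1 ≤ T.card := by
    simpa only [List.length_append, List.length_singleton] using length_le_card_symbols hπ'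
  have hmem {x : Fin (n + 1)} (hx : x ∈ T) : (x : ℕ) + 1 ∈ s ++ [n + 1] :=
    (Finset.mem_filter.1 hx).2
  have hle := dH_le_three_mul_card_compl (g := fmap π) (h := fmap σ) T fun a ha hb hc =>
    fmap_apply_eq_of_order_agree (T := (T : Set (Fin (n + 1))))
      (fun x hx y hy => inv_lt_inv_iff_of_sublist hπ' hσ' (hmem hx) (hmem hy)) ha hb hc
  rw [Finset.card_compl, Fintype.card_fin] at hle
  omega

/-- if `C_H ⊆ S_{n+1}` has minimum Hamming distance `3t+1`, then the
code `P_t(n) = {π ∈ S_n : f(π̄) ∈ C_H}` corrects `t` deletions. -/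
theorem stmt18 (t n : ℕ) (ht : 1 ≤ t) (hn : 3 * t + 1 ≤ n + 1)
    (CH : Set (Equiv.Perm (Fin (n+1))))
    (hCH : ∀ a ∈ CH, ∀ b ∈ CH, a ≠ b → 3 * t + 1 ≤ dH a b) :
    ∀ π σ : Equiv.Perm (Fin n), fmap π ∈ CH → fmap σ ∈ CH → π ≠ σ →
      Dball t π ∩ Dball t σ = ∅ := by
  intro π σ hπ hσ hne
  refine Set.eq_empty_iff_forall_notMem.2 fun s hs => ?_
  obtain ⟨⟨hsπ, hlen⟩, hsσ, -⟩ := hs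
  have hlow := hCH _ hπ _ hσ (fmap_injective.ne hne)
  have hupp := dH_fmap_le_of_common_subsequence hsπ hsσ
  omega
end
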